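/- Suppose δ > 0 and C > 0 are such that for every u ∈ C_0^∞(ℝ^{2n+1}) supported in the closed unit Euclidean ball of ℝ^{2n+1}, ‖(|D_t|^δ + |D_x|^δ + |D_v|^δ) u‖_{L²(ℝ^{2n+1})} ≤ C (‖iD_t u + i v·D_x u + |D_v|^{2σ} u‖_{L²(ℝ^{2n+1})} + ‖u‖_{L²(ℝ^{2n+1})}). Then necessarily δ ≤ 2σ/(2σ+1). -/

import Mathlib

open MeasureTheory
open scoped ENNReal Real

noncomputable section

/-- `ℝ^n` with the Euclidean norm. -/
abbrev E (n : ℕ) : Type := EuclideanSpace ℝ (Fin n)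
/-- `ℝ^{2n+1} = ℝ_t × ℝ^n_x × ℝ^n_v` with the Euclidean norm. -/
abbrev Z (n : ℕ) : Type := EuclideanSpace ℝ (Unit ⊕ Fin n ⊕ Fin n)

variable {n : ℕ}

/-- the `t` (resp. dual `τ`) coordinate -/
def tC (ζ : Z n) : ℝ := ζ (Sum.inl ())
/-- the `x` (resp. dual `ξ`) coordinates -/
def xC (ζ : Z n) : E n := WithLp.toLp 2 fun i => ζ (Sum.inr (Sum.inl i))
/-- the `v` (resp. dual `η`) coordinates -/
def vC (ζ : Z n) : E n := WithLp.toLp 2 fun i => ζ (Sum.inr (Sum.inr i))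

/-- the unit vector in the `t` direction -/
def eT : Z n := EuclideanSpace.single (Sum.inl ()) 1
/-- the unit vector in the `xᵢ` direction -/
def eX (i : Fin n) : Z n := EuclideanSpace.single (Sum.inr (Sum.inl i)) 1

/-- the Fourier multiplier `|D_v|^{2σ}`, with symbol `|η|^{2σ}` -/
def absDv (σ : ℝ) (u : Z n → ℂ) : Z n → ℂ :=
  FourierTransformInv.fourierInv (fun ζ => ((‖vC ζ‖ ^ (2 * σ) : ℝ) : ℂ) * FourierTransform.fourier u ζ)

/-- the model operator `iD_t + i v·D_x + |D_v|^{2σ}`, where `D = (2πi)^{-1}∂` -/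
def Qop (σ : ℝ) (u : Z n → ℂ) (z : Z n) : ℂ :=
  Complex.I * ((2 * (π : ℂ) * Complex.I)⁻¹ * fderiv ℝ u z eT)
    + Complex.I * ∑ i : Fin n,
        (vC z i : ℂ) * ((2 * (π : ℂ) * Complex.I)⁻¹ * fderiv ℝ u z (eX i))
    + absDv σ u z

theorem memLp_fourierInv_aux {V : Type*} [NormedAddCommGroup V] [InnerProductSpace ℝ V]
    [FiniteDimensional ℝ V] [MeasurableSpace V] [BorelSpace V] {g : V → ℂ}
    (h1 : Integrable g) (h2 : MemLp g 2) :
    MemLp (FourierTransformInv.fourierInv g) 2 := by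
  set f : Lp (α := V) ℂ 2 := h2.toLp g with hf
  set F : Lp (α := V) ℂ 2 := FourierTransformInv.fourierInv f with hF
  have hcont : Continuous (FourierTransformInv.fourierInv g) :=
    VectorFourier.fourierIntegral_continuous (L := -innerₗ V) Real.continuous_fourierChar
      (continuous_inner (𝕜 := ℝ) (E := V)).neg h1
  have key : ∀ᵐ x, F x = FourierTransformInv.fourierInv g x := by
    apply ae_eq_of_integral_contDiff_smul_eq
    · exact (Lp.memLp F).locallyIntegrable (by norm_num)
    · exact hcont.locallyIntegrable
    intro ψ hψ hc
    have hg₁ : HasCompactSupport (Complex.ofRealCLM ∘ ψ) := hc.comp_left rfl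
    have hg₂ : ContDiff ℝ (⊤ : ℕ∞) (Complex.ofRealCLM ∘ ψ) := by fun_prop
    set Ψ := hg₁.toSchwartzMap hg₂ with hΨ
    have e1 : ∫ x, ψ x • F x = Lp.toTemperedDistribution F Ψ := by
      simp [hΨ]
    have e2 : Lp.toTemperedDistribution F Ψ = ∫ x, (FourierTransformInv.fourierInv Ψ) x • f x := by
      rw [hF, ← Lp.fourierInv_toTemperedDistribution_eq, TemperedDistribution.fourierInv_apply,
        Lp.toTemperedDistribution_apply]
    have e3 : ∫ x, (FourierTransformInv.fourierInv Ψ) x • f x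
        = ∫ x, (FourierTransformInv.fourierInv (Ψ : V → ℂ)) x • g x := by
      apply integral_congr_ae
      filter_upwards [h2.coeFn_toLp] with x hx
      rw [hf, hx, SchwartzMap.fourierInv_coe]
    have e4 : ∫ x, (FourierTransformInv.fourierInv (Ψ : V → ℂ)) x • g x
        = ∫ x, Ψ x • FourierTransformInv.fourierInv g x := by
      have := VectorFourier.integral_fourierIntegral_smul_eq_flip (L := -innerₗ V)
        (μ := (volume : Measure V)) (ν := (volume : Measure V))
        Real.continuous_fourierChar
        (continuous_inner (𝕜 := ℝ) (E := V)).neg (Ψ.integrable) h1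
      have hfl : (-innerₗ V).flip = -innerₗ V := by
        ext x y
        simp [real_inner_comm]
      rw [hfl] at this
      exact this
    rw [e1, e2, e3, e4]
    simp [hΨ]
  exact (memLp_congr_ae key).1 (Lp.memLp F)

theorem vC_continuous : Continuous (vC : Z n → E n) := by unfold vC; fun_prop
theorem xC_continuous : Continuous (xC : Z n → E n) := by unfold xC; fun_prop

theorem norm_vC_le (ζ : Z n) : ‖vC ζ‖ ≤ ‖ζ‖ := by
  rw [EuclideanSpace.norm_eq, EuclideanSpace.norm_eq]
  apply Real.sqrt_le_sqrt
  simp only [Fintype.sum_sum_type, vC]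
  have h1 : 0 ≤ ∑ i : Unit, ‖ζ (Sum.inl i)‖ ^ 2 := Finset.sum_nonneg fun _ _ => by positivity
  have h2 : 0 ≤ ∑ i : Fin n, ‖ζ (Sum.inr (Sum.inl i))‖ ^ 2 :=
    Finset.sum_nonneg fun _ _ => by positivity
  linarith

theorem symbol_mem (σ : ℝ) (hσ0 : 0 < σ) (hσ1 : σ < 1) (f : SchwartzMap (Z n) ℂ)
    (p : ℝ≥0∞) :
    MemLp (fun ζ => ((‖vC ζ‖ ^ (2 * σ) : ℝ) : ℂ) * f ζ) p volume := by
  have htg : (fun ζ : Z n => ((1 + ‖ζ‖ ^ 2 : ℝ) : ℂ)).HasTemperateGrowth := by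
    have := (Function.HasTemperateGrowth.const (E := Z n) (1 : ℝ)).add
      (Function.hasTemperateGrowth_norm_sq (H := Z n))
    exact Function.Complex.hasTemperateGrowth_ofReal.comp this
  have hm := (SchwartzMap.smulLeftCLM ℂ (fun ζ : Z n => ((1 + ‖ζ‖ ^ 2 : ℝ) : ℂ)) f).memLp p volume
  refine hm.mono ?_ ?_
  · apply Continuous.aestronglyMeasurable
    have : Continuous fun ζ : Z n => ‖vC ζ‖ ^ (2 * σ) :=
      (vC_continuous.norm).rpow_const fun _ => Or.inr (by positivity)
    exact (Complex.continuous_ofReal.comp this).mul f.continuous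
  · refine Filter.Eventually.of_forall fun ζ => ?_
    rw [SchwartzMap.smulLeftCLM_apply_apply htg, norm_mul, norm_smul]
    gcongr
    rw [Complex.norm_real, Complex.norm_real, Real.norm_of_nonneg (by positivity),
      Real.norm_of_nonneg (by positivity)]
    have h0 := norm_nonneg (vC ζ)
    have hle := norm_vC_le ζ
    rcases le_total ‖vC ζ‖ 1 with h | h
    · have := Real.rpow_le_one h0 h (by positivity : 0 ≤ 2 * σ)
      nlinarith [sq_nonneg ‖ζ‖]
    · have := Real.rpow_le_rpow_of_exponent_le h (by linarith : 2 * σ ≤ 2)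
      rw [Real.rpow_two] at this
      nlinarith [norm_nonneg ζ]

theorem Qop_memLp (σ : ℝ) (hσ0 : 0 < σ) (hσ1 : σ < 1) (φ : Z n → ℂ)
    (h1 : ContDiff ℝ (⊤ : ℕ∞) φ) (h2 : HasCompactSupport φ) :
    MemLp (Qop σ φ) 2 volume := by
  have hd : Continuous (fderiv ℝ φ) := h1.continuous_fderiv (by simp)
  have hds : HasCompactSupport (fderiv ℝ φ) := h2.fderiv ℝ
  have hdv : ∀ e : Z n, HasCompactSupport (fun z => fderiv ℝ φ z e) := fun e =>
    hds.comp_left (g := fun L : Z n →L[ℝ] ℂ => L e) rfl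
  have hdc : ∀ e : Z n, Continuous (fun z => fderiv ℝ φ z e) := fun e =>
    hd.clm_apply continuous_const
  have hm : MemLp (absDv σ φ) 2 volume := by
    set f := FourierTransform.fourier (h2.toSchwartzMap h1) with hf
    have hfe : (f : Z n → ℂ) = FourierTransform.fourier φ := rfl
    have a1 := symbol_mem σ hσ0 hσ1 f 1
    have a2 := symbol_mem σ hσ0 hσ1 f 2
    rw [hfe] at a1 a2
    exact memLp_fourierInv_aux (memLp_one_iff_integrable.1 a1) a2
  unfold Qop
  refine MemLp.add (MemLp.add ?_ ?_) hm
  · exact (((hdc eT).memLp_of_hasCompactSupport (hdv eT)).const_mul _).const_mul _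
  · refine MemLp.const_mul (f := fun z : Z n => ∑ i : Fin n,
        (vC z i : ℂ) * ((2 * (π : ℂ) * Complex.I)⁻¹ * fderiv ℝ φ z (eX i))) ?_ _
    refine memLp_finsetSum (f := fun (i : Fin n) (z : Z n) =>
        (vC z i : ℂ) * ((2 * (π : ℂ) * Complex.I)⁻¹ * fderiv ℝ φ z (eX i))) _ fun i _ => ?_
    refine Continuous.memLp_of_hasCompactSupport ?_ ?_
    · have : Continuous fun z : Z n => ((vC z i : ℝ) : ℂ) := by unfold vC; fun_prop
      exact this.mul (continuous_const.mul (hdc _))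
    · exact ((hdv (eX i)).mul_left).mul_left

theorem scale_exists (A : Z n ≃L[ℝ] Z n) :
    ∃ J : ℝ, 0 < J ∧ (∀ f : Z n → ℂ, ∫ z, f (A z) = (J : ℂ) * ∫ z, f z) ∧
      ∃ s : ℝ≥0∞, s ≠ 0 ∧ s ≠ ⊤ ∧ s * s = ENNReal.ofReal J ∧
        ∀ f : Z n → ℂ, eLpNorm (fun z => f (A z)) 2 volume = s * eLpNorm f 2 volume := by
  have hdet : LinearMap.det (A.toLinearEquiv : Z n →ₗ[ℝ] Z n) ≠ 0 :=
    (LinearEquiv.isUnit_det' A.toLinearEquiv).ne_zero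
  have hmap := Measure.map_linearMap_addHaar_eq_smul_addHaar (volume : Measure (Z n)) hdet
  set J := |(LinearMap.det (A.toLinearEquiv : Z n →ₗ[ℝ] Z n))⁻¹| with hJ
  have hJ0 : 0 < J := abs_pos.2 (inv_ne_zero hdet)
  have hme : MeasurableEmbedding A := A.toHomeomorph.measurableEmbedding
  have hmap' : Measure.map A (volume : Measure (Z n)) = ENNReal.ofReal J • volume := hmap
  refine ⟨J, hJ0, fun f => ?_, ENNReal.ofReal J ^ (1 / 2 : ℝ), ?_, ?_, ?_, fun f => ?_⟩
  · rw [← hme.integral_map, hmap', integral_smul_measure, ENNReal.toReal_ofReal hJ0.le]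
    simp
  · simp [hJ0]
  · simp
  · rw [← ENNReal.rpow_add _ _ (by simpa using hJ0) (by simp)]
    norm_num
  · have := hme.eLpNorm_map_measure (g := f) (p := 2) (μ := volume)
    rw [hmap', eLpNorm_smul_measure_of_ne_top (by simp)] at this
    rw [show (fun z => f (A z)) = f ∘ A from rfl, ← this]
    simp

theorem fourier_scale (A : Z n ≃L[ℝ] Z n) (hA : ∀ z w, inner ℝ (A z) w = inner ℝ z (A w))
    (J : ℝ) (hJ : ∀ f : Z n → ℂ, ∫ z, f (A z) = (J : ℂ) * ∫ z, f z) (f : Z n → ℂ) (ζ : Z n) :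
    FourierTransform.fourier (fun z => f (A z)) ζ
      = (J : ℂ) * FourierTransform.fourier f (A.symm ζ) := by
  rw [Real.fourier_eq, Real.fourier_eq, ← hJ]
  congr 1
  ext z
  rw [hA, A.apply_symm_apply]

theorem fourierInv_scale (A : Z n ≃L[ℝ] Z n) (hA : ∀ z w, inner ℝ (A z) w = inner ℝ z (A w))
    (J : ℝ) (hJ : ∀ f : Z n → ℂ, ∫ z, f (A z) = (J : ℂ) * ∫ z, f z) (f : Z n → ℂ) (ζ : Z n) :
    FourierTransformInv.fourierInv f (A ζ)
      = (J : ℂ) * FourierTransformInv.fourierInv (fun z => f (A.symm z)) ζ := by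
  rw [Real.fourierInv_eq, Real.fourierInv_eq, ← hJ]
  congr 1
  ext z
  rw [hA, A.symm_apply_apply]

/-- weights of the anisotropic dilation -/
def wt (n : ℕ) (σ l : ℝ) : Unit ⊕ Fin n ⊕ Fin n → ℝ :=
  Sum.elim (fun _ => l ^ (2 * σ)) (Sum.elim (fun _ => l ^ (2 * σ + 1)) (fun _ => l))

/-- diagonal dilation -/
def dil (w : Unit ⊕ Fin n ⊕ Fin n → ℝ) (hw : ∀ i, w i ≠ 0) : Z n ≃L[ℝ] Z n :=
  LinearEquiv.toContinuousLinearEquiv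
  { toFun := fun z => WithLp.toLp 2 fun i => w i * z i
    invFun := fun z => WithLp.toLp 2 fun i => (w i)⁻¹ * z i
    map_add' := fun x y => by ext i; simp [mul_add]
    map_smul' := fun c x => by ext i; simp; ring
    left_inv := fun x => by ext i; simp [hw i]
    right_inv := fun x => by ext i; simp [hw i] }

@[simp] theorem dil_apply (w : Unit ⊕ Fin n ⊕ Fin n → ℝ) (hw : ∀ i, w i ≠ 0) (z : Z n) (i) :
    dil w hw z i = w i * z i := rfl

theorem dil_inner (w : Unit ⊕ Fin n ⊕ Fin n → ℝ) (hw : ∀ i, w i ≠ 0) (z y : Z n) :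
    inner ℝ (dil w hw z) y = inner ℝ z (dil w hw y) := by
  simp only [PiLp.inner_apply, dil_apply]
  refine Finset.sum_congr rfl fun i _ => ?_
  simp
  ring

theorem wt_one_le (σ : ℝ) (hσ : 0 < σ) (l : ℝ) (hl : 1 ≤ l) (i) : 1 ≤ wt n σ l i := by
  rcases i with i | i | i
  · exact Real.one_le_rpow hl (by positivity)
  · exact Real.one_le_rpow hl (by positivity)
  · exact hl

theorem norm_le_dil (w : Unit ⊕ Fin n ⊕ Fin n → ℝ) (hw : ∀ i, w i ≠ 0) (h1 : ∀ i, 1 ≤ w i)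
    (z : Z n) : ‖z‖ ≤ ‖dil w hw z‖ := by
  rw [EuclideanSpace.norm_eq, EuclideanSpace.norm_eq]
  apply Real.sqrt_le_sqrt
  refine Finset.sum_le_sum fun i _ => ?_
  rw [dil_apply, norm_mul]
  have := h1 i
  have h2 : 1 ≤ ‖w i‖ := this.trans (le_abs_self _)
  gcongr
  nlinarith [norm_nonneg (z i)]

theorem vC_dil (σ l : ℝ) (hw : ∀ i, wt n σ l i ≠ 0) (z : Z n) :
    vC (dil (wt n σ l) hw z) = l • vC z := by
  ext i; simp [vC, wt]

theorem xC_dil (σ l : ℝ) (hw : ∀ i, wt n σ l i ≠ 0) (z : Z n) :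
    xC (dil (wt n σ l) hw z) = (l ^ (2 * σ + 1)) • xC z := by
  ext i; simp [xC, wt]

theorem dil_eT (σ l : ℝ) (hw : ∀ i, wt n σ l i ≠ 0) :
    dil (wt n σ l) hw eT = (l ^ (2 * σ)) • eT := by
  ext i
  rcases i with i | i | i <;> simp [eT, wt]

theorem dil_eX (σ l : ℝ) (hw : ∀ i, wt n σ l i ≠ 0) (j : Fin n) :
    dil (wt n σ l) hw (eX j) = (l ^ (2 * σ + 1)) • eX j := by
  ext i
  rcases i with i | i | i <;> simp [eX, wt]

theorem Qop_scale (σ l : ℝ) (hl : 1 ≤ l) (hw : ∀ i, wt n σ l i ≠ 0)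
    (φ : Z n → ℂ) (hφ : Differentiable ℝ φ) (z : Z n) :
    Qop σ (fun z => φ (dil (wt n σ l) hw z)) z
      = ((l ^ (2 * σ) : ℝ) : ℂ) * Qop σ φ (dil (wt n σ l) hw z) := by
  have hl0 : 0 < l := by linarith
  obtain ⟨J, hJ0, hJ, -⟩ := scale_exists (dil (wt n σ l) hw)
  set A := dil (wt n σ l) hw with hA
  have hfd : ∀ e, fderiv ℝ (fun z => φ (A z)) z e = fderiv ℝ φ (A z) (A e) := by
    intro e
    have := (hφ (A z)).hasFDerivAt.comp z A.hasFDerivAt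
    rw [show (fun z => φ (A z)) = φ ∘ A from rfl, this.fderiv]
    rfl
  have habs : absDv σ (fun z => φ (A z)) z
      = ((l ^ (2 * σ) : ℝ) : ℂ) * absDv σ φ (A z) := by
    unfold absDv
    rw [fourierInv_scale A (dil_inner _ hw) J hJ]
    have : (fun ζ : Z n => ((‖vC ζ‖ ^ (2 * σ) : ℝ) : ℂ) *
          FourierTransform.fourier (fun z => φ (A z)) ζ)
        = fun ζ => (((l ^ (2 * σ) : ℝ) : ℂ) * (J : ℂ)) • (((‖vC (A.symm ζ)‖ ^ (2 * σ) : ℝ) : ℂ) *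
          FourierTransform.fourier φ (A.symm ζ)) := by
      ext ζ
      rw [fourier_scale A (dil_inner _ hw) J hJ]
      have h1 : vC ζ = l • vC (A.symm ζ) := by
        rw [← vC_dil σ l hw, ← hA, A.apply_symm_apply]
      rw [h1, norm_smul, Real.norm_of_nonneg hl0.le, Real.mul_rpow hl0.le (norm_nonneg _)]
      push_cast
      simp only [smul_eq_mul]
      ring
    rw [this, Real.fourierInv_eq, Real.fourierInv_eq, ← mul_assoc,
      ← integral_const_mul]
    congr 1
    ext v
    rw [smul_comm, smul_eq_mul]
  unfold Qop
  rw [habs, hfd, hA, dil_eT, mul_add, mul_add]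
  congr 1
  congr 1
  · rw [map_smul, Complex.real_smul]; ring
  · rw [mul_left_comm, Finset.mul_sum (a := ((l ^ (2 * σ) : ℝ) : ℂ))]
    congr 1
    refine Finset.sum_congr rfl fun i _ => ?_
    rw [← hA, hfd, hA, dil_eX, map_smul, Complex.real_smul, vC_dil, Real.rpow_add_one hl0.ne']
    simp
    ring

theorem scaled_ineq (σ : ℝ) (hσ0 : 0 < σ) 
    (δ : ℝ) (hδ : 0 < δ) (C : ℝ)
    (hyp : ∀ u : Z n → ℂ, ContDiff ℝ (⊤ : ℕ∞) u → HasCompactSupport u →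
      tsupport u ⊆ Metric.closedBall (0 : Z n) 1 →
      eLpNorm (fun ζ => (((|tC ζ| ^ δ + ‖xC ζ‖ ^ δ + ‖vC ζ‖ ^ δ) : ℝ) : ℂ)
          * FourierTransform.fourier u ζ) 2 volume
        ≤ ENNReal.ofReal C *
          (eLpNorm (Qop σ u) 2 volume + eLpNorm u 2 volume))
    (φ : Z n → ℂ) (h1 : ContDiff ℝ (⊤ : ℕ∞) φ) 
    (h3 : tsupport φ ⊆ Metric.closedBall (0 : Z n) 1) (l : ℝ) (hl : 1 ≤ l) :
    ENNReal.ofReal (l ^ ((2 * σ + 1) * δ)) *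
      eLpNorm (fun ζ => ((‖xC ζ‖ ^ δ : ℝ) : ℂ) * FourierTransform.fourier φ ζ) 2 volume
      ≤ ENNReal.ofReal C * (ENNReal.ofReal (l ^ (2 * σ)) * eLpNorm (Qop σ φ) 2 volume
        + eLpNorm φ 2 volume) := by
  have hl0 : 0 < l := by linarith
  have hw1 := wt_one_le (n := n) σ hσ0 l hl
  have hw : ∀ i, wt n σ l i ≠ 0 := fun i => by linarith [hw1 i]
  have hsc := scale_exists (dil (wt n σ l) hw)
  have hQ : Qop σ (fun z => φ (dil (wt n σ l) hw z)) =
      fun z => ((l ^ (2 * σ) : ℝ) : ℂ) • Qop σ φ (dil (wt n σ l) hw z) := by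
    ext z
    exact Qop_scale σ l hl hw φ (h1.differentiable (by simp)) z
  have hx := xC_dil (n := n) σ l hw
  have hin := dil_inner _ hw
  have hnl := norm_le_dil _ hw hw1
  generalize dil (wt n σ l) hw = A at *
  obtain ⟨J, hJ0, hJ, s, hs0, hst, hss, hs⟩ := hsc
  have hsupp : tsupport (fun z => φ (A z)) ⊆ Metric.closedBall (0 : Z n) 1 := by
    refine closure_minimal (fun z hz => ?_) Metric.isClosed_closedBall
    have : A z ∈ Metric.closedBall (0 : Z n) 1 := h3 (subset_tsupport _ hz)
    rw [mem_closedBall_zero_iff] at this ⊢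
    exact (hnl z).trans this
  have hcs : HasCompactSupport (fun z => φ (A z)) :=
    (isCompact_closedBall (0 : Z n) 1).of_isClosed_subset (isClosed_tsupport _) hsupp
  have hm := hyp (fun z => φ (A z)) (h1.comp A.contDiff) hcs hsupp
  rw [hQ, hs φ] at hm
  have hq2 : eLpNorm (fun z => ((l ^ (2 * σ) : ℝ) : ℂ) • Qop σ φ (A z)) 2 volume
      = ENNReal.ofReal (l ^ (2 * σ)) * (s * eLpNorm (Qop σ φ) 2 volume) := by
    rw [← hs]
    have := eLpNorm_const_smul ((l ^ (2 * σ) : ℝ) : ℂ) (fun z => Qop σ φ (A z)) 2 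
      (volume : Measure (Z n))
    rw [← ofReal_norm, Complex.norm_real, Real.norm_of_nonneg (by positivity)] at this
    exact this
  rw [hq2] at hm
  set N := eLpNorm (fun ζ => ((‖xC ζ‖ ^ δ : ℝ) : ℂ) * FourierTransform.fourier φ ζ) 2 volume with hN
  -- lower bound
  have hlow : ENNReal.ofReal (l ^ ((2 * σ + 1) * δ)) * (s * N) ≤
      eLpNorm (fun ζ => (((|tC ζ| ^ δ + ‖xC ζ‖ ^ δ + ‖vC ζ‖ ^ δ) : ℝ) : ℂ)
          * FourierTransform.fourier (fun z => φ (A z)) ζ) 2 volume := by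
    set h := fun ζ : Z n => ((‖xC ζ‖ ^ δ : ℝ) : ℂ) * FourierTransform.fourier φ ζ with hh
    have e1 : N = s * eLpNorm (fun ζ => h (A.symm ζ)) 2 volume := by
      rw [← hs (fun ζ => h (A.symm ζ))]
      simp only [A.symm_apply_apply]
      exact hN
    have e2 : ENNReal.ofReal (l ^ ((2 * σ + 1) * δ)) * (s * N)
        = eLpNorm (((l ^ ((2 * σ + 1) * δ) * J : ℝ) : ℂ) • (fun ζ => h (A.symm ζ))) 2 volume := by
      rw [eLpNorm_const_smul, ← ofReal_norm, Complex.norm_real,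
        Real.norm_of_nonneg (by positivity), ENNReal.ofReal_mul (by positivity), ← hss, e1]
      ring
    rw [e2]
    refine eLpNorm_mono fun ζ => ?_
    rw [fourier_scale A hin J hJ]
    have h1 : xC ζ = (l ^ (2 * σ + 1)) • xC (A.symm ζ) := by
      rw [← hx, A.apply_symm_apply]
    have h2 : ‖xC ζ‖ ^ δ = l ^ ((2 * σ + 1) * δ) * ‖xC (A.symm ζ)‖ ^ δ := by
      rw [h1, norm_smul, Real.norm_of_nonneg (by positivity),
        Real.mul_rpow (by positivity) (norm_nonneg _), Real.rpow_mul hl0.le]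
    have h3 : ‖xC ζ‖ ^ δ ≤ |tC ζ| ^ δ + ‖xC ζ‖ ^ δ + ‖vC ζ‖ ^ δ := by
      have := Real.rpow_nonneg (abs_nonneg (tC ζ)) δ
      have := Real.rpow_nonneg (norm_nonneg (vC ζ)) δ
      linarith
    rw [Pi.smul_apply, norm_smul, hh, norm_mul, norm_mul, norm_mul, Complex.norm_real,
      Complex.norm_real, Complex.norm_real, Complex.norm_real,
      Real.norm_of_nonneg (by positivity), Real.norm_of_nonneg (by positivity),
      Real.norm_of_nonneg (by positivity), Real.norm_of_nonneg hJ0.le]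
    calc _ = (‖xC ζ‖ ^ δ) * (J * ‖FourierTransform.fourier φ (A.symm ζ)‖) := by rw [h2]; ring
      _ ≤ _ := by gcongr
  have hfin := hlow.trans hm
  have : s * (ENNReal.ofReal (l ^ ((2 * σ + 1) * δ)) * N) ≤
      s * (ENNReal.ofReal C * (ENNReal.ofReal (l ^ (2 * σ)) * eLpNorm (Qop σ φ) 2 volume
        + eLpNorm φ 2 volume)) := by
    calc _ = ENNReal.ofReal (l ^ ((2 * σ + 1) * δ)) * (s * N) := by ring
      _ ≤ _ := hfin
      _ = _ := by ring
  exact (ENNReal.mul_le_mul_iff_right hs0 hst).1 this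

theorem exists_bump (hn : 1 ≤ n) (δ : ℝ) (hδ : 0 < δ) : ∃ φ : Z n → ℂ,
    ContDiff ℝ (⊤ : ℕ∞) φ ∧ HasCompactSupport φ ∧
    tsupport φ ⊆ Metric.closedBall (0 : Z n) 1 ∧
    eLpNorm (fun ζ => ((‖xC ζ‖ ^ δ : ℝ) : ℂ) * FourierTransform.fourier φ ζ) 2 volume ≠ 0 := by
  let b : ContDiffBump (0 : Z n) := ⟨1 / 2, 1, by norm_num, by norm_num⟩
  have hcd : ContDiff ℝ (⊤ : ℕ∞) (fun z => ((b z : ℝ) : ℂ)) :=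
    Complex.ofRealCLM.contDiff.comp b.contDiff
  have hsub : tsupport (fun z => ((b z : ℝ) : ℂ)) ⊆ Metric.closedBall (0 : Z n) 1 := by
    refine closure_minimal (fun z hz => ?_) Metric.isClosed_closedBall
    have : z ∈ Function.support b := by
      intro h0; apply hz; simp [h0]
    rw [b.support_eq] at this
    exact Metric.ball_subset_closedBall this
  have hcs : HasCompactSupport (fun z => ((b z : ℝ) : ℂ)) :=
    (isCompact_closedBall (0 : Z n) 1).of_isClosed_subset (isClosed_tsupport _) hsub
  refine ⟨fun z => ((b z : ℝ) : ℂ), hcd, hcs, hsub, fun h0 => ?_⟩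
  set φ := fun z : Z n => ((b z : ℝ) : ℂ) with hφ
  set f := FourierTransform.fourier (hcs.toSchwartzMap hcd) with hf
  have hfe : (f : Z n → ℂ) = FourierTransform.fourier φ := rfl
  rw [← hfe] at h0
  have hc : Continuous (fun ζ : Z n => ((‖xC ζ‖ ^ δ : ℝ) : ℂ) * f ζ) := by
    have : Continuous fun ζ : Z n => ‖xC ζ‖ ^ δ :=
      (xC_continuous.norm).rpow_const fun _ => Or.inr hδ.le
    exact (Complex.continuous_ofReal.comp this).mul f.continuous
  rw [eLpNorm_eq_zero_iff hc.aestronglyMeasurable (by simp)] at h0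
  have hz := (Continuous.ae_eq_iff_eq volume hc continuous_const).1 h0
  have hf0 : f 0 ≠ 0 := by
    rw [hfe, Real.fourier_eq]
    simp only [inner_zero_right, neg_zero, AddChar.map_zero_eq_one, one_smul, hφ]
    rw [integral_complex_ofReal]
    exact_mod_cast (b.integral_pos (μ := volume)).ne'
  let i : Fin n := ⟨0, hn⟩
  have hlim : Filter.Tendsto (fun r : ℝ => f (r • eX i)) (nhdsWithin 0 {0}ᶜ) (nhds (f 0)) := by
    have : Continuous (fun r : ℝ => f (r • eX i)) := f.continuous.comp (by fun_prop)
    have := this.tendsto 0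
    rw [zero_smul] at this
    exact this.mono_left nhdsWithin_le_nhds
  have hev : (fun r : ℝ => f (r • eX i)) =ᶠ[nhdsWithin 0 {0}ᶜ] fun _ => 0 := by
    filter_upwards [self_mem_nhdsWithin] with r hr
    have hr : r ≠ 0 := hr
    have := congrFun hz (r • eX i)
    have hx : xC (r • eX i : Z n) ≠ 0 := by
      intro h
      have := congrArg (fun v : E n => v i) h
      simp [xC, eX] at this
      exact hr this
    have hp : 0 < ‖xC (r • eX i : Z n)‖ ^ δ := Real.rpow_pos_of_pos (norm_pos_iff.2 hx) _
    rcases mul_eq_zero.1 this with h | h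
    · exact absurd (by exact_mod_cast h) hp.ne'
    · exact h
  exact hf0 (tendsto_nhds_unique hlim ((Filter.tendsto_congr' hev).2 tendsto_const_nhds))

/-- optimality of the gain `2σ/(2σ+1)`.  If the a priori
estimate with gain `δ` holds for all test functions supported in the closed
unit ball, then `δ ≤ 2σ/(2σ+1)`. -/
theorem statement3
    (n : ℕ) (hn : 1 ≤ n) (σ : ℝ) (hσ0 : 0 < σ) (hσ1 : σ < 1)
    (δ : ℝ) (hδ : 0 < δ) (C : ℝ) (hC : 0 < C)
    (hyp : ∀ u : Z n → ℂ, ContDiff ℝ (⊤ : ℕ∞) u → HasCompactSupport u →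
      tsupport u ⊆ Metric.closedBall (0 : Z n) 1 →
      eLpNorm (fun ζ => (((|tC ζ| ^ δ + ‖xC ζ‖ ^ δ + ‖vC ζ‖ ^ δ) : ℝ) : ℂ)
          * FourierTransform.fourier u ζ) 2 volume
        ≤ ENNReal.ofReal C *
          (eLpNorm (Qop σ u) 2 volume + eLpNorm u 2 volume)) :
    δ ≤ 2 * σ / (2 * σ + 1) := by
  obtain ⟨φ, h1, h2, h3, hN⟩ := exists_bump hn δ hδ
  have key := scaled_ineq σ hσ0 δ hδ C hyp φ h1 h3
  have hM := (Qop_memLp σ hσ0 hσ1 φ h1 h2).eLpNorm_ne_top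
  have hK := (h1.continuous.memLp_of_hasCompactSupport (p := 2) (μ := volume) h2).eLpNorm_ne_top
  generalize eLpNorm (fun ζ => ((‖xC ζ‖ ^ δ : ℝ) : ℂ) * FourierTransform.fourier φ ζ) 2 volume = N
    at *
  generalize eLpNorm (Qop σ φ) 2 volume = M at *
  generalize eLpNorm φ 2 volume = K at *
  by_contra hcon
  push Not at hcon
  rw [div_lt_iff₀ (by positivity)] at hcon
  lift M to NNReal using hM
  lift K to NNReal using hK
  have hNt : N ≠ ⊤ := by
    intro h
    have := key 1 le_rfl
    rw [h] at this
    simp [ENNReal.mul_eq_top] at this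
  lift N to NNReal using hNt
  have hN' : (0 : ℝ) < N := by
    have : N ≠ 0 := by exact_mod_cast hN
    exact_mod_cast pos_iff_ne_zero.2 this
  have key2 : ∀ l : ℝ, 1 ≤ l → l ^ (δ * (2 * σ + 1) - 2 * σ) ≤ C * (M + K) / N := by
    intro l hl
    have hl0 : 0 < l := by linarith
    have h := ENNReal.toReal_mono (by finiteness) (key l hl)
    rw [ENNReal.toReal_mul, ENNReal.toReal_mul, ENNReal.toReal_add (by finiteness) (by finiteness),
      ENNReal.toReal_mul, ENNReal.toReal_ofReal (by positivity), ENNReal.toReal_ofReal hC.le,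
      ENNReal.toReal_ofReal (by positivity)] at h
    simp only [ENNReal.coe_toReal] at h
    have hp : 0 < l ^ (2 * σ) := by positivity
    have hone : 1 ≤ l ^ (2 * σ) := Real.one_le_rpow hl (by positivity)
    rw [Real.rpow_sub hl0, le_div_iff₀ hN', div_mul_eq_mul_div, div_le_iff₀ hp]
    rw [mul_comm δ]
    refine h.trans ?_
    have hK0 : (0 : ℝ) ≤ K := K.2
    have : (K : ℝ) ≤ K * l ^ (2 * σ) := by nlinarith
    calc C * (l ^ (2 * σ) * M + K) ≤ C * (l ^ (2 * σ) * M + K * l ^ (2 * σ)) := by gcongr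
      _ = _ := by ring
  have ht := tendsto_rpow_atTop (y := δ * (2 * σ + 1) - 2 * σ) (by linarith)
  obtain ⟨l, hl1, hl2⟩ := ((ht.eventually_gt_atTop (C * (M + K) / N)).and
    (Filter.eventually_ge_atTop 1)).exists
  exact absurd (key2 l hl2) (not_le.2 hl1)
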